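/- For every positive integer n, the free abelian group ℤ^n does not admit an n-tuple of right-invariant linear orders that is generic. In particular, ℤ^m admits a right-invariant generic n-tuple of orders if and only if m > n. -/

import Mathlib

open Filter Topology

/-- Floor relative to a dominating positive element. -/
lemma exists_floor_aux {G : Type} [AddCommGroup G] [LinearOrder G] [IsOrderedAddMonoid G]
    (e : G) (he : 0 < e) (hdom : ∀ x : G, ∃ N : ℕ, x ≤ (N : ℤ) • e) (x : G) :
    ∃ p : ℤ, p • e ≤ x ∧ x < (p + 1) • e := by
  obtain ⟨N, hN⟩ := hdom x
  obtain ⟨M, hM⟩ := hdom (-x)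
  have h1 : ∃ b : ℤ, ∀ z : ℤ, z • e ≤ x → z ≤ b :=
    ⟨N, fun z hz => (zsmul_le_zsmul_iff_left he).1 (hz.trans hN)⟩
  have h2 : ∃ z : ℤ, z • e ≤ x := ⟨-M, by rw [neg_zsmul]; exact neg_le.1 hM⟩
  obtain ⟨p, hp, hp'⟩ := Int.exists_greatest_of_bdd h1 h2
  refine ⟨p, hp, ?_⟩
  by_contra hcon
  have := hp' (p + 1) (not_lt.1 hcon)
  omega

lemma exists_hom_aux {G : Type} [AddCommGroup G] [LinearOrder G] [IsOrderedAddMonoid G]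
    (e : G) (he : 0 < e) (hdom : ∀ x : G, ∃ N : ℕ, x ≤ (N : ℤ) • e) :
    ∃ f : G →+ ℝ, f e = 1 ∧ ∀ x, 0 < x → 0 ≤ f x := by
  choose fl hfl1 hfl2 using exists_floor_aux e he hdom
  have hlt : ∀ a b : ℤ, a • e < b • e → a < b := fun a b h => (zsmul_lt_zsmul_iff_left he).1 h
  have hadd : ∀ x y, fl x + fl y ≤ fl (x + y) ∧ fl (x + y) ≤ fl x + fl y + 1 := by
    intro x y
    constructor
    · have : (fl x + fl y) • e < (fl (x + y) + 1) • e := by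
        rw [add_zsmul]
        exact (add_le_add (hfl1 x) (hfl1 y)).trans_lt (hfl2 _)
      have := hlt _ _ this
      omega
    · have : (fl (x + y)) • e < ((fl x + 1) + (fl y + 1)) • e := by
        rw [add_zsmul]
        exact (hfl1 _).trans_lt (add_lt_add (hfl2 x) (hfl2 y))
      have := hlt _ _ this
      omega
  have hpos : ∀ x, 0 ≤ x → 0 ≤ fl x := by
    intro x hx
    have : (0 : ℤ) • e < (fl x + 1) • e := by
      rw [zero_zsmul]; exact hx.trans_lt (hfl2 x)
    have := hlt _ _ this
    omega
  have hfe : ∀ k : ℕ, fl ((k : ℕ) • e) = k := by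
    intro k
    have h1 := hfl1 ((k : ℕ) • e)
    have h2 := hfl2 ((k : ℕ) • e)
    rw [← natCast_zsmul] at h1 h2
    have h1 := (zsmul_le_zsmul_iff_left he).1 h1
    have h2 := hlt _ _ h2
    rw [← natCast_zsmul]
    omega
  let φ : ℕ → G → ℝ := fun k x => (fl ((k + 1) • x) : ℝ) / ((k + 1 : ℕ) : ℝ)
  have hbd : ∀ x, ∃ C : ℝ, ∀ k, φ k x ∈ Set.Icc (-C) C := by
    intro x
    obtain ⟨N, hN⟩ := hdom x
    obtain ⟨M, hM⟩ := hdom (-x)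
    refine ⟨N + M + 1, fun k => ?_⟩
    have hk : (0 : ℝ) < ((k + 1 : ℕ) : ℝ) := by positivity
    have a1 : fl ((k + 1) • x) ≤ (k + 1 : ℕ) * N := by
      have : fl ((k + 1) • x) • e ≤ (((k + 1 : ℕ) : ℤ) * N) • e := by
        refine (hfl1 _).trans ?_
        rw [mul_smul, natCast_zsmul _ (k + 1)]
        exact nsmul_le_nsmul_right hN _
      exact (zsmul_le_zsmul_iff_left he).1 this
    have a2 : -((k + 1 : ℕ) * M : ℤ) < fl ((k + 1) • x) + 1 := by
      apply hlt
      refine lt_of_le_of_lt ?_ (hfl2 _)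
      rw [neg_zsmul, mul_smul, natCast_zsmul _ (k + 1), neg_le, ← smul_neg]
      exact nsmul_le_nsmul_right hM _
    have b1 : (fl ((k + 1) • x) : ℝ) ≤ ((k + 1 : ℕ) : ℝ) * N := by exact_mod_cast a1
    have b2 : -(((k + 1 : ℕ) : ℝ) * M) < (fl ((k + 1) • x) : ℝ) + 1 := by exact_mod_cast a2
    have hk1 : (1 : ℝ) ≤ ((k + 1 : ℕ) : ℝ) := by push_cast; linarith [(Nat.cast_nonneg k : (0:ℝ) ≤ k)]
    have hM0 : (0 : ℝ) ≤ M := Nat.cast_nonneg M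
    have hN0 : (0 : ℝ) ≤ N := Nat.cast_nonneg N
    constructor
    · simp only [φ]; rw [le_div_iff₀ hk]; nlinarith [mul_nonneg hk.le hM0, mul_nonneg hk.le hN0]
    · simp only [φ]; rw [div_le_iff₀ hk]; nlinarith [mul_nonneg hk.le hM0, mul_nonneg hk.le hN0]
  have hlim : ∀ x, ∃ l : ℝ, Tendsto (fun k => φ k x) (hyperfilter ℕ : Filter ℕ) (𝓝 l) := by
    intro x
    obtain ⟨C, hC⟩ := hbd x
    obtain ⟨l, -, hl⟩ := (isCompact_Icc (a := -C) (b := C)).ultrafilter_le_nhds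
      ((hyperfilter ℕ).map (fun k => φ k x))
      (by
        rw [le_principal_iff]
        exact Filter.mem_map.2 (Filter.mem_of_superset univ_mem (fun k _ => hC k)))
    exact ⟨l, hl⟩
  choose f hf using hlim
  have hinv : Tendsto (fun k : ℕ => 1 / ((k : ℝ) + 1)) (hyperfilter ℕ : Filter ℕ) (𝓝 0) :=
    tendsto_one_div_add_atTop_nhds_zero_nat.mono_left Nat.hyperfilter_le_atTop
  refine ⟨AddMonoidHom.mk' f ?_, ?_, ?_⟩
  · intro x y
    have h1 : Tendsto (fun k => φ k (x + y) - (φ k x + φ k y)) (hyperfilter ℕ : Filter ℕ) (𝓝 0) := by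
      refine squeeze_zero ?_ ?_ hinv
      · intro k
        have hk : (0 : ℝ) < ((k + 1 : ℕ) : ℝ) := by positivity
        have := (hadd ((k + 1) • x) ((k + 1) • y)).1
        rw [← nsmul_add] at this
        have h' : (fl ((k + 1) • x) : ℝ) + fl ((k + 1) • y) ≤ fl ((k + 1) • (x + y)) := by
          exact_mod_cast this
        simp only [φ]
        rw [← add_div, ← sub_div]
        apply div_nonneg _ hk.le
        linarith
      · intro k
        have hk : (0 : ℝ) < ((k + 1 : ℕ) : ℝ) := by positivity
        have := (hadd ((k + 1) • x) ((k + 1) • y)).2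
        rw [← nsmul_add] at this
        have h' : (fl ((k + 1) • (x + y)) : ℝ) ≤ (fl ((k + 1) • x) : ℝ) + fl ((k + 1) • y) + 1 := by
          exact_mod_cast this
        simp only [φ]
        rw [← add_div, ← sub_div]
        have e1 : (k : ℝ) + 1 = ((k + 1 : ℕ) : ℝ) := by push_cast; ring
        rw [e1]
        apply div_le_div_of_nonneg_right _ hk.le
        linarith
    have h2 := (hf (x + y)).sub ((hf x).add (hf y))
    have := tendsto_nhds_unique h1 h2
    linarith
  · have h1 : Tendsto (fun k => φ k e) (hyperfilter ℕ : Filter ℕ) (𝓝 1) := by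
      refine tendsto_const_nhds.congr (fun k => ?_)
      have hk : (0 : ℝ) < ((k + 1 : ℕ) : ℝ) := by positivity
      simp only [φ, hfe]
      rw [Int.cast_natCast, div_self hk.ne']
    exact tendsto_nhds_unique (hf e) h1
  · intro x hx
    refine ge_of_tendsto' (hf x) (fun k => ?_)
    have := hpos ((k + 1) • x) (nsmul_nonneg hx.le _)
    have h' : (0 : ℝ) ≤ fl ((k + 1) • x) := by exact_mod_cast this
    exact div_nonneg h' (Nat.cast_nonneg _)

lemma exists_functional_aux {m : ℕ} (hm : 0 < m) {G : Type} [AddCommGroup G] [LinearOrder G]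
    [IsOrderedAddMonoid G] (φ : (Fin m → ℤ) ≃+ G) :
    ∃ f : Fin m → ℝ, f ≠ 0 ∧ ∀ x : Fin m → ℤ, 0 < φ x → 0 ≤ ∑ j, f j * (x j : ℝ) := by
  have : Nonempty (Fin m) := ⟨⟨0, hm⟩⟩
  let b : Fin m → G := fun j => φ (Pi.single j 1)
  have hx : ∀ x : Fin m → ℤ, φ x = ∑ j, x j • b j := by
    intro x
    have : x = ∑ j, x j • (Pi.single j 1 : Fin m → ℤ) := by
      funext i
      simp [Finset.sum_apply, Pi.single_apply]
    conv_lhs => rw [this]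
    rw [map_sum]
    exact Finset.sum_congr rfl (fun j _ => map_zsmul φ _ _)
  obtain ⟨j0, hj0⟩ := Finite.exists_max (fun j => |b j|)
  have hb0 : b j0 ≠ 0 := by
    intro h
    have h2 : (Pi.single j0 1 : Fin m → ℤ) = 0 := φ.injective (by rw [map_zero]; exact h)
    have := congrFun h2 j0
    simp at this
  have he : 0 < |b j0| := abs_pos.2 hb0
  obtain ⟨f, hf1, hf2⟩ := exists_hom_aux (|b j0|) he (by
    intro g
    obtain ⟨x, rfl⟩ := φ.surjective g
    refine ⟨∑ j, (x j).natAbs, ?_⟩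
    rw [hx]
    refine (le_abs_self _).trans ((Finset.abs_sum_le_sum_abs _ _).trans ?_)
    rw [natCast_zsmul, Finset.sum_smul]
    refine Finset.sum_le_sum (fun j _ => ?_)
    rw [abs_zsmul, ← natCast_zsmul, Int.natCast_natAbs]
    exact zsmul_le_zsmul_right (abs_nonneg _) (hj0 j))
  have hfx : ∀ x : Fin m → ℤ, f (φ x) = ∑ j, f (b j) * (x j : ℝ) := by
    intro x
    rw [hx, map_sum]
    refine Finset.sum_congr rfl (fun j _ => ?_)
    rw [map_zsmul, zsmul_eq_mul, mul_comm]
  refine ⟨fun j => f (b j), ?_, ?_⟩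
  · intro h
    have h0 : f (b j0) = 0 := congrFun h j0
    rcases abs_choice (b j0) with h' | h' <;> rw [h'] at hf1 <;> simp [h0] at hf1
  · intro x hx0
    rw [← hfx]
    exact hf2 _ hx0

lemma exists_functional {m : ℕ} (hm : 0 < m) (lt : (Fin m → ℤ) → (Fin m → ℤ) → Prop)
    (h1 : IsStrictTotalOrder (Fin m → ℤ) lt)
    (h2 : ∀ x y g : Fin m → ℤ, lt x y → lt (x + g) (y + g)) :
    ∃ f : Fin m → ℝ, f ≠ 0 ∧ ∀ x y : Fin m → ℤ, lt x y →
      ∑ j, f j * (x j : ℝ) ≤ ∑ j, f j * (y j : ℝ) := by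
  classical
  let L : LinearOrder (Fin m → ℤ) := linearOrderOfSTO lt
  have I : @IsOrderedAddMonoid (Fin m → ℤ) _ L.toPreorder :=
    @IsOrderedAddMonoid.mk (Fin m → ℤ) _ L.toPreorder (by
      intro a b hab c
      rcases hab with h | h
      · exact Or.inl (by rw [h])
      · exact Or.inr (h2 _ _ _ h)) (by
      intro a b hab c
      rcases hab with h | h
      · exact Or.inl (by rw [h])
      · exact Or.inr (by rw [add_comm c a, add_comm c b]; exact h2 _ _ _ h))
  obtain ⟨f, hf0, hf⟩ := @exists_functional_aux m hm (Fin m → ℤ) _ L I (AddEquiv.refl _)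
  refine ⟨f, hf0, fun x y hxy => ?_⟩
  have h3 : lt 0 (y - x) := by
    have := h2 _ _ (-x) hxy
    rwa [add_neg_cancel, ← sub_eq_add_neg] at this
  have := hf (y - x) h3
  simp only [Pi.sub_apply, Int.cast_sub, mul_sub, Finset.sum_sub_distrib] at this
  linarith

lemma no_generic {n m : ℕ} (hm : 0 < m) (hmn : m ≤ n)
    (lt : Fin n → (Fin m → ℤ) → (Fin m → ℤ) → Prop)
    (h1 : ∀ i, IsStrictTotalOrder (Fin m → ℤ) (lt i))
    (h2 : ∀ i, ∀ x y g : Fin m → ℤ, lt i x y → lt i (x + g) (y + g))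
    (h3 : ∀ x y : Fin n → (Fin m → ℤ), (∀ i, lt i (x i) (y i)) →
        ∃ z : Fin m → ℤ, ∀ i, lt i (x i) z ∧ lt i z (y i)) : False := by
  classical
  choose f hf0 hf using fun i => exists_functional hm (lt i) (h1 i) (h2 i)
  let F : Fin n → (Fin m → ℤ) → ℝ := fun i x => ∑ j, f i j * (x j : ℝ)
  have hFneg : ∀ i x, F i (-x) = - F i x := by intro i x; simp [F]
  have hF0 : ∀ i, F i 0 = 0 := by intro i; simp [F]
  have hF : ∀ i x y, lt i x y → F i x ≤ F i y := hf
  -- positive vectors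
  have hv : ∀ i, ∃ v, 0 < F i v := by
    intro i
    obtain ⟨j, hj⟩ := Function.ne_iff.1 (hf0 i)
    have hs : F i (Pi.single j 1) = f i j := by
      simp [F, Pi.single_apply]
    rcases lt_or_gt_of_ne hj with h | h
    · exact ⟨-Pi.single j 1, by rw [hFneg, hs]; simpa using h⟩
    · exact ⟨Pi.single j 1, by rw [hs]; simpa using h⟩
  choose v hv using hv
  have hv0 : ∀ i, lt i 0 (v i) := by
    intro i
    have := h1 i
    rcases trichotomous_of (lt i) 0 (v i) with h | h | h
    · exact h
    · have := hv i
      rw [← h, hF0] at this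
      exact absurd this (lt_irrefl _)
    · have := hF i _ _ h
      rw [hF0] at this
      exact absurd (hv i) (not_lt.2 this)
  by_cases hli : LinearIndependent ℝ f
  · have hcard : n ≤ m := by simpa using hli.fintype_card_le_finrank
    have hnm : n = m := le_antisymm hcard hmn
    have : Nonempty (Fin n) := ⟨⟨0, by omega⟩⟩
    have hspan : Submodule.span ℝ (Set.range f) = ⊤ :=
      hli.span_eq_top_of_card_eq_finrank (by simp [hnm])
    have hc : ∀ j : Fin m, ∃ c : Fin n → ℝ, ∑ i, c i • f i = Pi.single j 1 := by
      intro j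
      have : (Pi.single j 1 : Fin m → ℝ) ∈ Submodule.span ℝ (Set.range f) := by
        rw [hspan]; trivial
      exact (Submodule.mem_span_range_iff_exists_fun ℝ).1 this
    choose c hc using hc
    have hcz : ∀ j (z : Fin m → ℤ), (z j : ℝ) = ∑ i, c j i * F i z := by
      intro j z
      have e1 : ∑ i, c j i * F i z = ∑ k, (∑ i, c j i • f i) k * (z k : ℝ) := by
        simp only [F, Finset.mul_sum, Finset.sum_apply, Finset.sum_mul, Pi.smul_apply, smul_eq_mul]
        rw [Finset.sum_comm]
        simp only [mul_assoc]
      rw [e1, hc]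
      simp [Pi.single_apply]
    let S : Set (Fin m → ℤ) := {z | ∀ i, lt i 0 z ∧ lt i z (v i)}
    have hSfin : S.Finite := by
      let B : Fin m → ℤ := fun j => ⌈∑ i, |c j i| * F i (v i)⌉
      refine (Set.Finite.pi (fun j => Set.finite_Icc (-(B j)) (B j))).subset ?_
      intro z hz j _
      have hb : |(z j : ℝ)| ≤ B j := by
        rw [hcz]
        refine (Finset.abs_sum_le_sum_abs _ _).trans (le_trans ?_ (Int.le_ceil _))
        refine Finset.sum_le_sum (fun i _ => ?_)
        rw [abs_mul]
        have g1 := hF i _ _ (hz i).1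
        have g2 := hF i _ _ (hz i).2
        rw [hF0] at g1
        rw [abs_of_nonneg g1]
        exact mul_le_mul_of_nonneg_left g2 (abs_nonneg _)
      have hb' : |z j| ≤ B j := by exact_mod_cast hb
      exact abs_le.1 hb'
    obtain ⟨z0, hz0⟩ := h3 (fun _ => 0) v hv0
    let i0 : Fin n := Classical.arbitrary _
    have := fun i => h1 i
    have hwf := hSfin.wellFoundedOn (r := lt i0)
    obtain ⟨w, hwS, hw⟩ := hwf.has_min (Set.univ : Set S) ⟨⟨z0, hz0⟩, trivial⟩
    obtain ⟨z, hz⟩ := h3 (fun _ => 0) (fun _ => (w : Fin m → ℤ)) (fun i => (w.2 i).1)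
    have hzS : z ∈ S := fun i => ⟨(hz i).1, _root_.trans (hz i).2 (w.2 i).2⟩
    exact hw ⟨z, hzS⟩ trivial (hz i0).2
  · obtain ⟨c, hc, i0, hi0⟩ := Fintype.not_linearIndependent_iff.1 hli
    have hsum : ∀ z, ∑ i, c i * F i z = 0 := by
      intro z
      have e1 : ∑ i, c i * F i z = ∑ k, (∑ i, c i • f i) k * (z k : ℝ) := by
        simp only [F, Finset.mul_sum, Finset.sum_apply, Finset.sum_mul, Pi.smul_apply, smul_eq_mul]
        rw [Finset.sum_comm]
        simp only [mul_assoc]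
      rw [e1, hc]
      simp
    have hex : ∀ i, ∃ x y, lt i x y ∧ ∀ z, lt i x z → lt i z y →
        0 ≤ c i * F i z ∧ (c i ≠ 0 → 0 < c i * F i z) := by
      intro i
      rcases lt_trichotomy (c i) 0 with h | h | h
      · refine ⟨-v i + -v i, -v i, ?_, ?_⟩
        · have := h2 i _ _ (-v i + -v i) (hv0 i)
          simpa using this
        · intro z _ hz
          have := hF i _ _ hz
          rw [hFneg] at this
          have h' := hv i
          have : 0 < c i * F i z := mul_pos_of_neg_of_neg h (by linarith)
          exact ⟨this.le, fun _ => this⟩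
      · exact ⟨0, v i, hv0 i, fun z _ _ => by simp [h]⟩
      · refine ⟨v i, v i + v i, ?_, ?_⟩
        · have := h2 i _ _ (v i) (hv0 i)
          simpa using this
        · intro z hz _
          have := hF i _ _ hz
          have h' := hv i
          have : 0 < c i * F i z := mul_pos h (by linarith)
          exact ⟨this.le, fun _ => this⟩
    choose x y hxy hcF using hex
    obtain ⟨z, hz⟩ := h3 x y hxy
    have : 0 < ∑ i, c i * F i z :=
      Finset.sum_pos' (fun i _ => (hcF i z (hz i).1 (hz i).2).1)
        ⟨i0, Finset.mem_univ _, (hcF i0 z (hz i0).1 (hz i0).2).2 hi0⟩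
    rw [hsum] at this
    exact lt_irrefl _ this

/-- Evaluation of a real matrix on an integer vector. -/
def evl {n m : ℕ} (F : Fin n → Fin m → ℝ) (i : Fin n) (z : Fin m → ℤ) : ℝ :=
  ∑ j, F i j * (z j : ℝ)

lemma continuous_evl {n m : ℕ} (i : Fin n) (z : Fin m → ℤ) :
    Continuous (fun F : Fin n → Fin m → ℝ => evl F i z) := by
  unfold evl
  fun_prop

lemma dense_ne {n m : ℕ} (i : Fin n) (z : Fin m → ℤ) (hz : z ≠ 0) :
    Dense {F : Fin n → Fin m → ℝ | evl F i z ≠ 0} := by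
  intro F
  obtain ⟨j0, hj0⟩ := Function.ne_iff.1 hz
  by_cases h : evl F i z = 0
  swap
  · exact subset_closure h
  let Q : ℕ → Fin n → Fin m → ℝ := fun k i j => F i j + 1 / ((k : ℝ) + 1) * (z j : ℝ)
  have hQ : Tendsto Q atTop (𝓝 F) := by
    rw [tendsto_pi_nhds]; intro a
    rw [tendsto_pi_nhds]; intro b
    have := (tendsto_one_div_add_atTop_nhds_zero_nat (𝕜 := ℝ)).mul_const (z b : ℝ)
    have := this.const_add (F a b)
    simpa [Q] using this
  refine mem_closure_of_tendsto hQ (Eventually.of_forall fun k => ?_)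
  have e1 : evl (Q k) i z = evl F i z + 1 / ((k : ℝ) + 1) * ∑ j, (z j : ℝ) * (z j : ℝ) := by
    simp only [evl, Q, add_mul, Finset.sum_add_distrib, Finset.mul_sum, mul_assoc]
  have hpos : 0 < ∑ j, (z j : ℝ) * (z j : ℝ) :=
    Finset.sum_pos' (fun j _ => mul_self_nonneg _)
      ⟨j0, Finset.mem_univ _, mul_self_pos.2 (by simpa using hj0)⟩
  change evl (Q k) i z ≠ 0
  rw [e1, h, zero_add]
  positivity

lemma dense_hit {n m : ℕ} (hnm : n < m) (a b : Fin n → ℝ) (hab : ∀ i, a i < b i) :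
    Dense {F : Fin n → Fin m → ℝ | ∃ z : Fin m → ℤ, ∀ i, a i < evl F i z ∧ evl F i z < b i} := by
  intro F
  have hker : ∃ w : Fin m → ℝ, w ≠ 0 ∧ (Matrix.of F).mulVec w = 0 := by
    have h := LinearMap.ker_ne_bot_of_finrank_lt (f := Matrix.mulVecLin (Matrix.of F))
      (by simpa using hnm)
    obtain ⟨w, hw, hw0⟩ := (Submodule.ne_bot_iff _).1 h
    exact ⟨w, hw0, by simpa using hw⟩
  obtain ⟨w', hw', hFw'⟩ := hker
  obtain ⟨j0, hj0⟩ := Function.ne_iff.1 hw'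
  have hj0' : w' j0 ≠ 0 := hj0
  let w : Fin m → ℝ := fun j => w' j / w' j0
  have hw1 : w j0 = 1 := div_self hj0'
  have hFw : ∀ i, ∑ j, F i j * w j = 0 := by
    intro i
    have h := congrFun hFw' i
    simp only [Matrix.mulVec, dotProduct, Matrix.of_apply, Pi.zero_apply] at h
    simp only [w, ← mul_div_assoc]
    rw [← Finset.sum_div, h, zero_div]
  let z : ℕ → Fin m → ℤ := fun t j => ⌊((t : ℝ) + 1) * w j⌋
  have hz0 : ∀ t, (z t j0 : ℝ) = (t : ℝ) + 1 := by
    intro t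
    simp only [z, hw1, mul_one]
    have : ((t : ℝ) + 1) = (((t + 1 : ℕ) : ℤ) : ℝ) := by push_cast; ring
    rw [this, Int.floor_intCast]
  have hbd : ∀ t i, |evl F i (z t)| ≤ ∑ j, |F i j| := by
    intro t i
    have e1 : evl F i (z t) = ∑ j, F i j * ((z t j : ℝ) - ((t : ℝ) + 1) * w j) := by
      have : ∑ j, F i j * (((t : ℝ) + 1) * w j) = 0 := by
        have h := hFw i
        calc _ = ((t : ℝ) + 1) * ∑ j, F i j * w j := by
              rw [Finset.mul_sum]; exact Finset.sum_congr rfl (fun _ _ => by ring)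
          _ = 0 := by rw [h, mul_zero]
      simp only [mul_sub, Finset.sum_sub_distrib, this, sub_zero, evl]
    rw [e1]
    refine (Finset.abs_sum_le_sum_abs _ _).trans (Finset.sum_le_sum fun j _ => ?_)
    rw [abs_mul]
    refine mul_le_of_le_one_right (abs_nonneg _) ?_
    have g1 := Int.floor_le (((t : ℝ) + 1) * w j)
    have g2 := Int.lt_floor_add_one (((t : ℝ) + 1) * w j)
    rw [abs_le]
    constructor <;> simp only [z] <;> linarith
  let u : Fin n → ℝ := fun i => (a i + b i) / 2
  let Q : ℕ → Fin n → Fin m → ℝ := fun t i j =>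
    F i j + if j = j0 then (u i - evl F i (z t)) * (1 / ((t : ℝ) + 1)) else 0
  have hQ : Tendsto Q atTop (𝓝 F) := by
    rw [tendsto_pi_nhds]; intro i
    rw [tendsto_pi_nhds]; intro j
    by_cases hj : j = j0
    · have h0 : Tendsto (fun t : ℕ => (u i - evl F i (z t)) * (1 / ((t : ℝ) + 1))) atTop (𝓝 0) := by
        refine bdd_le_mul_tendsto_zero' (|u i| + ∑ j, |F i j|) ?_
          (tendsto_one_div_add_atTop_nhds_zero_nat (𝕜 := ℝ))
        refine Eventually.of_forall fun t => ?_
        exact (abs_sub _ _).trans (add_le_add le_rfl (hbd t i))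
      have := h0.const_add (F i j)
      simpa [Q, hj] using this
    · simp [Q, hj]
  refine mem_closure_of_tendsto hQ (Eventually.of_forall fun t => ⟨z t, fun i => ?_⟩)
  have e1 : evl (Q t) i (z t) = u i := by
    have : evl (Q t) i (z t) = evl F i (z t) +
        (u i - evl F i (z t)) * (1 / ((t : ℝ) + 1)) * (z t j0 : ℝ) := by
      simp only [evl, Q, add_mul, Finset.sum_add_distrib, ite_mul, zero_mul, Finset.sum_ite_eq',
        Finset.mem_univ, if_true]
    have ht : (t : ℝ) + 1 ≠ 0 := by positivity
    rw [this, hz0, mul_assoc, one_div_mul_cancel ht]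
    ring
  have := hab i
  rw [e1]
  simp only [u]
  constructor <;> linarith

lemma exists_good {n m : ℕ} (hnm : n < m) : ∃ F : Fin n → Fin m → ℝ,
    (∀ i z, z ≠ 0 → evl F i z ≠ 0) ∧
    ∀ a b : Fin n → ℚ, (∀ i, a i < b i) →
      ∃ z : Fin m → ℤ, ∀ i, (a i : ℝ) < evl F i z ∧ evl F i z < b i := by
  let I1 := Fin n × {z : Fin m → ℤ // z ≠ 0}
  let I2 := {p : (Fin n → ℚ) × (Fin n → ℚ) // ∀ i, p.1 i < p.2 i}
  let s : I1 ⊕ I2 → Set (Fin n → Fin m → ℝ) := Sum.elim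
    (fun p => {F | evl F p.1 p.2.1 ≠ 0})
    (fun p => {F | ∃ z : Fin m → ℤ, ∀ i, (p.1.1 i : ℝ) < evl F i z ∧ evl F i z < p.1.2 i})
  have hd : Dense (⋂ k, s k) := by
    apply dense_iInter_of_isOpen
    · rintro (⟨i, z, hz⟩ | ⟨⟨a, b⟩, hab⟩)
      · exact isOpen_ne_fun (continuous_evl i z) continuous_const
      · simp only [s, Sum.elim_inr, Set.ofPred_exists, Set.ofPred_forall, Set.ofPred_and]
        refine isOpen_iUnion fun z => isOpen_iInter_of_finite fun i => ?_
        exact (isOpen_lt continuous_const (continuous_evl i z)).inter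
          (isOpen_lt (continuous_evl i z) continuous_const)
    · rintro (⟨i, z, hz⟩ | ⟨⟨a, b⟩, hab⟩)
      · exact dense_ne i z hz
      · exact dense_hit hnm (fun i => (a i : ℝ)) (fun i => (b i : ℝ))
          (fun i => by exact_mod_cast hab i)
  obtain ⟨F, hF⟩ := hd.nonempty
  rw [Set.mem_iInter] at hF
  exact ⟨F, fun i z hz => hF (Sum.inl (i, ⟨z, hz⟩)),
    fun a b hab => hF (Sum.inr ⟨(a, b), hab⟩)⟩

lemma exists_generic {n m : ℕ} (hnm : n < m) :
    ∃ lt : Fin n → (Fin m → ℤ) → (Fin m → ℤ) → Prop,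
        (∀ i, IsStrictTotalOrder (Fin m → ℤ) (lt i)) ∧
        (∀ i, ∀ x y g : Fin m → ℤ, lt i x y → lt i (x + g) (y + g)) ∧
        (∀ x y : Fin n → (Fin m → ℤ), (∀ i, lt i (x i) (y i)) →
          ∃ z : Fin m → ℤ, ∀ i, lt i (x i) z ∧ lt i z (y i)) := by
  obtain ⟨F, hF1, hF2⟩ := exists_good hnm
  have hadd : ∀ i x y, evl F i (x + y) = evl F i x + evl F i y := by
    intro i x y
    simp [evl, mul_add, Finset.sum_add_distrib]
  have hinj : ∀ i, Function.Injective (evl F i) := by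
    intro i x y hxy
    by_contra hne
    apply hF1 i (x - y) (sub_ne_zero.2 hne)
    have := hadd i (x - y) y
    rw [sub_add_cancel] at this
    linarith
  refine ⟨fun i x y => evl F i x < evl F i y, ?_, ?_, ?_⟩
  · intro i
    exact { trichotomous := fun x y h1 h2 => hinj i (le_antisymm (not_lt.1 h2) (not_lt.1 h1))
            irrefl := fun x => lt_irrefl _
            trans := fun x y z => lt_trans }
  · intro i x y g h
    simp only [hadd]
    linarith
  · intro x y h
    have hq : ∀ i, ∃ a b : ℚ, a < b ∧ evl F i (x i) < a ∧ (b : ℝ) < evl F i (y i) := by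
      intro i
      obtain ⟨a, ha1, ha2⟩ := exists_rat_btwn (h i)
      obtain ⟨b, hb1, hb2⟩ := exists_rat_btwn ha2
      exact ⟨a, b, by exact_mod_cast hb1, ha1, hb2⟩
    choose a b hab ha hb using hq
    obtain ⟨z, hz⟩ := hF2 a b hab
    exact ⟨z, fun i => ⟨(ha i).trans (hz i).1, (hz i).2.trans (hb i)⟩⟩

/-- For every positive `n`, the group `ℤ^n` admits no generic `n`-tuple of
right-invariant linear orders; consequently `ℤ^m` admits a generic right-invariant
`n`-tuple of orders if and only if `m > n`. -/
theorem stmt_16 (n : ℕ) (hn : 0 < n) :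
    (¬ ∃ lt : Fin n → (Fin n → ℤ) → (Fin n → ℤ) → Prop,
      (∀ i, IsStrictTotalOrder (Fin n → ℤ) (lt i)) ∧
      (∀ i, ∀ x y g : Fin n → ℤ, lt i x y → lt i (x + g) (y + g)) ∧
      (∀ x y : Fin n → (Fin n → ℤ), (∀ i, lt i (x i) (y i)) →
        ∃ z : Fin n → ℤ, ∀ i, lt i (x i) z ∧ lt i z (y i))) ∧
    (∀ m : ℕ, 0 < m →
      ((∃ lt : Fin n → (Fin m → ℤ) → (Fin m → ℤ) → Prop,
        (∀ i, IsStrictTotalOrder (Fin m → ℤ) (lt i)) ∧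
        (∀ i, ∀ x y g : Fin m → ℤ, lt i x y → lt i (x + g) (y + g)) ∧
        (∀ x y : Fin n → (Fin m → ℤ), (∀ i, lt i (x i) (y i)) →
          ∃ z : Fin m → ℤ, ∀ i, lt i (x i) z ∧ lt i z (y i))) ↔ n < m)) := by
  refine ⟨?_, fun m hm => ⟨?_, fun h => exists_generic h⟩⟩
  · rintro ⟨lt, h1, h2, h3⟩
    exact no_generic hn le_rfl lt h1 h2 h3
  · rintro ⟨lt, h1, h2, h3⟩
    by_contra hcon
    exact no_generic hm (not_lt.1 hcon) lt h1 h2 h3
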